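/- Let K be a field of characteristic different from 2, let e ≥ 1 be an integer invertible in K, let c ∈ K^×, and set L := K[s]/(s^e − c), a finite étale K-algebra. Then the trace form q_{L/K}(x) := Tr_{L/K}(x^2) satisfies, in the Grothendieck–Witt ring GW(K): q_{L/K} = ⟨e⟩ + ((e−1)/2)·H if e is odd, and q_{L/K} = ⟨e⟩ + ⟨e·c⟩ + ((e−2)/2)·H if e is even, where H = ⟨1⟩ + ⟨−1⟩ is the hyperbolic class. -/

import Mathlib

open Polynomial in
theorem aux_trace (K : Type) [Field K] (e : ℕ) (he : 1 ≤ e) (c : K) (m : ℕ) (hm : m < 2 * e) :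
    Algebra.trace K (AdjoinRoot (X ^ e - C c)) (AdjoinRoot.root (X ^ e - C c) ^ m)
      = if m = 0 then (e : K) else if m = e then (e : K) * c else 0 := by
  have hmon : (X ^ e - C c : K[X]).Monic := monic_X_pow_sub_C c (by omega)
  have hne : (X ^ e - C c : K[X]) ≠ 0 := hmon.ne_zero
  have hdeg : (X ^ e - C c : K[X]).natDegree = e := natDegree_X_pow_sub_C
  set s := AdjoinRoot.root (X ^ e - C c) with hs
  have hse : s ^ e = algebraMap K _ c := by
    have := AdjoinRoot.eval₂_root (X ^ e - C c)
    simp only [eval₂_sub, eval₂_pow, eval₂_X, eval₂_C] at this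
    exact sub_eq_zero.mp this
  have pbd : (AdjoinRoot.powerBasis hne).dim = e := by simp [hdeg]
  have hfin : Module.finrank K (AdjoinRoot (X ^ e - C c)) = e := by
    rw [(AdjoinRoot.powerBasis hne).finrank, pbd]
  have key : ∀ n : ℕ, 0 < n → n < e →
      Algebra.trace K (AdjoinRoot (X ^ e - C c)) (s ^ n) = 0 := by
    intro n h0 h1
    rw [Algebra.trace_eq_matrix_trace (AdjoinRoot.powerBasis hne).basis, Matrix.trace]
    apply Finset.sum_eq_zero
    intro i _
    have hi : (i : ℕ) < e := i.2.trans_eq pbd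
    have hrep : ∀ j : ℕ, j < e → j ≠ (i : ℕ) →
        (AdjoinRoot.powerBasis hne).basis.repr (s ^ j) i = 0 := by
      intro j hj hji
      have : s ^ j = (AdjoinRoot.powerBasis hne).basis ⟨j, pbd.symm ▸ hj⟩ := by
        rw [PowerBasis.basis_eq_pow, AdjoinRoot.powerBasis_gen]
      rw [this, Module.Basis.repr_self, Finsupp.single_apply, if_neg]
      intro h; apply hji; rw [← h]
    rw [Matrix.diag_apply, Algebra.leftMulMatrix_eq_repr_mul, PowerBasis.basis_eq_pow,
      AdjoinRoot.powerBasis_gen, ← hs, ← pow_add]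
    by_cases h : n + i < e
    · exact hrep _ h (by omega)
    · obtain ⟨d, hd⟩ := Nat.exists_eq_add_of_le (not_lt.mp h)
      rw [hd, pow_add, hse, ← Algebra.smul_def, map_smul, Finsupp.smul_apply,
        hrep d (by omega) (by omega), smul_zero]
  split_ifs with h0 h1
  · subst h0
    rw [pow_zero, ← map_one (algebraMap K _), Algebra.trace_algebraMap, hfin]; simp
  · rw [h1, hse, Algebra.trace_algebraMap, hfin]; simp
  · by_cases h : m < e
    · exact key m (by omega) h
    · obtain ⟨d, hd⟩ := Nat.exists_eq_add_of_le (not_lt.mp h)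
      rw [hd, pow_add, hse, ← Algebra.smul_def, map_smul, key d (by omega) (by omega), smul_zero]

theorem trace_form_of_radical_extension
    (K : Type) [Field K] (h2 : (2 : K) ≠ 0)
    (e : ℕ) (he : 1 ≤ e) (heK : (e : K) ≠ 0)
    (c : K) (hc : c ≠ 0) :
    ∃ b : Module.Basis (Fin e) K (AdjoinRoot (Polynomial.X ^ e - Polynomial.C c)),
      ∀ i j : Fin e,
        Algebra.traceForm K (AdjoinRoot (Polynomial.X ^ e - Polynomial.C c)) (b i) (b j)
          = Matrix.diagonal
              (fun i : Fin e =>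
                if (i : ℕ) = 0 then (e : K)
                else if e % 2 = 0 ∧ (i : ℕ) = 1 then (e : K) * c
                else if (i : ℕ) % 2 = 0 then (-1 : K) else 1) i j := by
  classical
  have hmon : (Polynomial.X ^ e - Polynomial.C c : Polynomial K).Monic :=
    Polynomial.monic_X_pow_sub_C c (by omega)
  have hdeg : (Polynomial.X ^ e - Polynomial.C c : Polynomial K).natDegree = e :=
    Polynomial.natDegree_X_pow_sub_C
  have hfin : Module.finrank K (AdjoinRoot (Polynomial.X ^ e - Polynomial.C c)) = e := by
    rw [(AdjoinRoot.powerBasis hmon.ne_zero).finrank]; simp [hdeg]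
  have hfd : Module.Finite K (AdjoinRoot (Polynomial.X ^ e - Polynomial.C c)) :=
    (AdjoinRoot.powerBasis hmon.ne_zero).finite
  set s := AdjoinRoot.root (Polynomial.X ^ e - Polynomial.C c) with hs
  set B := Algebra.traceForm K (AdjoinRoot (Polynomial.X ^ e - Polynomial.C c)) with hB
  have hT : ∀ a b : ℕ, a + b < 2 * e → B (s ^ a) (s ^ b) =
      if a + b = 0 then (e : K) else if a + b = e then (e : K) * c else 0 := by
    intro a b h
    rw [hB, Algebra.traceForm_apply, ← pow_add, aux_trace K e he c _ h]
  have hec : (e : K) * c ≠ 0 := mul_ne_zero heK hc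
  let t : K := (2 * (e * c))⁻¹
  have ht : t * (e * c) * 2 = 1 := by
    simp only [t]; field_simp
  let k : ℕ → ℕ := fun i => (i + e % 2) / 2
  let v : Fin e → AdjoinRoot (Polynomial.X ^ e - Polynomial.C c) := fun i =>
    if (i : ℕ) = 0 then s ^ 0
    else if e % 2 = 0 ∧ (i : ℕ) = 1 then s ^ (e / 2)
    else if (i : ℕ) % 2 = 0 then s ^ (k i) + (-t) • s ^ (e - k i)
    else s ^ (k i) + t • s ^ (e - k i)
  let d : Fin e → K := fun i : Fin e =>
                if (i : ℕ) = 0 then (e : K)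
                else if e % 2 = 0 ∧ (i : ℕ) = 1 then (e : K) * c
                else if (i : ℕ) % 2 = 0 then (-1 : K) else 1
  have hd : ∀ i, d i ≠ 0 := by
    intro i
    simp only [d]
    split_ifs <;> first | assumption | simp
  have hk : ∀ i : ℕ, i < e → i ≠ 0 → ¬ (e % 2 = 0 ∧ i = 1) → 1 ≤ k i ∧ 2 * k i < e := by
    intro i _ _ _
    simp only [k]
    omega
  have hpair : ∀ (a b : ℕ) (x y : K), 1 ≤ a → 2 * a < e → 1 ≤ b → 2 * b < e →
      B (s ^ a + x • s ^ (e - a)) (s ^ b + y • s ^ (e - b)) =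
        if a = b then (x + y) * (e * c) else 0 := by
    intro a b x y h1 h2 h3 h4
    simp only [map_add, map_smul, LinearMap.add_apply, LinearMap.smul_apply, smul_eq_mul]
    have e1 : B (s ^ a) (s ^ b) = 0 := by
      rw [hT a b (by omega), if_neg (by omega), if_neg (by omega)]
    have e2 : B (s ^ (e - a)) (s ^ (e - b)) = 0 := by
      rw [hT _ _ (by omega), if_neg (by omega), if_neg (by omega)]
    have e3 : B (s ^ a) (s ^ (e - b)) = if a = b then (e : K) * c else 0 := by
      rw [hT _ _ (by omega), if_neg (by omega)]
      exact if_congr (by omega) rfl rfl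
    have e4 : B (s ^ (e - a)) (s ^ b) = if a = b then (e : K) * c else 0 := by
      rw [hT _ _ (by omega), if_neg (by omega)]
      exact if_congr (by omega) rfl rfl
    rw [e1, e2, e3, e4]
    split_ifs <;> ring
  have hsing : ∀ (n b : ℕ) (y : K), (n = 0 ∨ 2 * n = e) → 1 ≤ b → 2 * b < e →
      B (s ^ n) (s ^ b + y • s ^ (e - b)) = 0 := by
    intro n b y h1 h3 h4
    simp only [map_add, map_smul, smul_eq_mul]
    rw [hT n b (by omega), hT n (e - b) (by omega)]
    rw [if_neg (by omega), if_neg (by omega), if_neg (by omega), if_neg (by omega)]; ring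
  have hsymm : ∀ x y, B x y = B y x := fun x y => by
    rw [hB, Algebra.traceForm_apply, Algebra.traceForm_apply, mul_comm]
  have hG : ∀ i j, i ≤ j → B (v i) (v j) = Matrix.diagonal d i j := by
    intro i j hij
    have hij' : (i : ℕ) ≤ j := hij
    have hi := i.2
    have hj := j.2
    by_cases h : i = j
    · subst h
      rw [Matrix.diagonal_apply_eq]
      simp only [v, d]
      split_ifs with h0 h1 h2
      · rw [hT _ _ (by omega), if_pos rfl]
      · rw [hT _ _ (by omega), if_neg (by omega), if_pos (by omega)]
      · obtain ⟨ha, hb⟩ := hk i hi h0 h1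
        rw [hpair _ _ _ _ ha hb ha hb, if_pos rfl]
        linear_combination -ht
      · obtain ⟨ha, hb⟩ := hk i hi h0 h1
        rw [hpair _ _ _ _ ha hb ha hb, if_pos rfl]
        linear_combination ht
    · rw [Matrix.diagonal_apply_ne _ h]
      have hne : (i : ℕ) ≠ j := fun h' => h (Fin.ext h')
      have hpp : ∀ x y : K, ((i : ℕ) % 2 = (j : ℕ) % 2 ∨ x + y = 0) → (i : ℕ) ≠ 0 →
          ¬ (e % 2 = 0 ∧ (i : ℕ) = 1) → (j : ℕ) ≠ 0 → ¬ (e % 2 = 0 ∧ (j : ℕ) = 1) →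
          B (s ^ k i + x • s ^ (e - k i)) (s ^ k j + y • s ^ (e - k j)) = 0 := by
        intro x y hxy h1 h2 h3 h4
        obtain ⟨ha, hb⟩ := hk i hi h1 h2
        obtain ⟨ha', hb'⟩ := hk j hj h3 h4
        rw [hpair _ _ _ _ ha hb ha' hb']
        split_ifs with hkk
        · rcases hxy with hxy | hxy
          · simp only [k] at hkk; omega
          · rw [hxy, zero_mul]
        · rfl
      have hss : ∀ (n : ℕ) (y : K), (n = 0 ∨ 2 * n = e) → (j : ℕ) ≠ 0 →
          ¬ (e % 2 = 0 ∧ (j : ℕ) = 1) → B (s ^ n) (s ^ k j + y • s ^ (e - k j)) = 0 := by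
        intro n y hn h3 h4
        obtain ⟨ha', hb'⟩ := hk j hj h3 h4
        exact hsing _ _ _ hn ha' hb'
      simp only [v]
      by_cases hj0 : (j : ℕ) = 0
      · omega
      rw [if_neg hj0]
      by_cases hj1 : e % 2 = 0 ∧ (j : ℕ) = 1
      · rw [if_pos hj1, if_pos (by omega), hT _ _ (by omega), if_neg (by omega),
          if_neg (by omega)]
      rw [if_neg hj1]
      by_cases hi0 : (i : ℕ) = 0
      · rw [if_pos hi0]
        split_ifs
        · exact hss _ _ (by omega) hj0 hj1
        · exact hss _ _ (by omega) hj0 hj1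
      rw [if_neg hi0]
      by_cases hi1 : e % 2 = 0 ∧ (i : ℕ) = 1
      · rw [if_pos hi1]
        split_ifs
        · exact hss _ _ (by omega) hj0 hj1
        · exact hss _ _ (by omega) hj0 hj1
      rw [if_neg hi1]
      split_ifs with p q q
      · exact hpp _ _ (Or.inl (by omega)) hi0 hi1 hj0 hj1
      · exact hpp _ _ (Or.inr (by ring)) hi0 hi1 hj0 hj1
      · exact hpp _ _ (Or.inr (by ring)) hi0 hi1 hj0 hj1
      · exact hpp _ _ (Or.inl (by omega)) hi0 hi1 hj0 hj1
  have hG' : ∀ i j, B (v i) (v j) = Matrix.diagonal d i j := by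
    intro i j
    rcases le_total i j with h | h
    · exact hG i j h
    · rw [hsymm, hG j i h]
      by_cases hij : i = j
      · rw [hij]
      · rw [Matrix.diagonal_apply_ne _ hij, Matrix.diagonal_apply_ne' _ hij]
  have hli : LinearIndependent K v := by
    rw [Fintype.linearIndependent_iff]
    intro g hg i
    have h := congrArg (fun x => B x (v i)) hg
    simp only [map_sum, map_smul, LinearMap.sum_apply, LinearMap.smul_apply, hG', map_zero,
      LinearMap.zero_apply, smul_eq_mul, Matrix.diagonal_apply, mul_ite, mul_zero,
      Finset.sum_ite_eq', Finset.mem_univ, if_true] at h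
    exact (mul_eq_zero.mp h).resolve_right (hd i)
  have : Nonempty (Fin e) := ⟨⟨0, he⟩⟩
  refine ⟨basisOfLinearIndependentOfCardEqFinrank hli (by rw [hfin, Fintype.card_fin]), ?_⟩
  intro i j
  rw [coe_basisOfLinearIndependentOfCardEqFinrank]
  exact hG' i j
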